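/- Let ι be a finite index set and c : ι → ℂ, a, b, m, p : ι → ℕ. Define F : ℝ → ℂ by F(k) = Σ_{l ∈ ι} c_l · (cos(a_l·k))^{m_l} · (sin(b_l·k))^{2·p_l}. Then there exist α ∈ ℕ and a polynomial P over ℂ with natural degree at most 2α satisfying P.coeff i = P.coeff (2α − i) for every i ≤ 2α, such that for every k ∈ ℝ, F(k) = P.eval(exp(i·k)) / exp(i·α·k). -/

import Mathlib

open scoped BigOperators

open Polynomial in
/-- `P` is palindromic relative to the degree `N`. -/
def IsPalindromic (N : ℕ) (P : ℂ[X]) : Prop :=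
  P.natDegree ≤ N ∧ P.reflect N = P

namespace IsPalindromic

open Polynomial

variable {M N : ℕ} {P Q : ℂ[X]}

theorem add (hP : IsPalindromic N P) (hQ : IsPalindromic N Q) : IsPalindromic N (P + Q) :=
  ⟨natDegree_add_le_of_degree_le hP.1 hQ.1, by rw [reflect_add, hP.2, hQ.2]⟩

theorem mul (hP : IsPalindromic M P) (hQ : IsPalindromic N Q) :
    IsPalindromic (M + N) (P * Q) :=
  ⟨natDegree_mul_le_of_le hP.1 hQ.1, by rw [reflect_mul P Q hP.1 hQ.1, hP.2, hQ.2]⟩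

theorem const (r : ℂ) : IsPalindromic 0 (C r) :=
  ⟨(natDegree_C r).le, by simp [reflect_C]⟩

theorem X_pow (n : ℕ) : IsPalindromic (2 * n) (X ^ n) :=
  ⟨by simp only [natDegree_X_pow]; omega, by
    rw [reflect_monomial, revAt_le (by omega), two_mul, Nat.add_sub_cancel]⟩

theorem one_add_X_pow (n : ℕ) : IsPalindromic n (1 + X ^ n) :=
  ⟨natDegree_add_le_of_degree_le (by simp) (by simp), by
    rw [reflect_add, reflect_one, reflect_monomial, revAt_le le_rfl, Nat.sub_self, pow_zero,
      add_comm]⟩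

theorem coeff_eq (hP : IsPalindromic N P) {i : ℕ} (hi : i ≤ N) :
    P.coeff i = P.coeff (N - i) := by
  conv_lhs => rw [← hP.2, coeff_reflect, revAt_le hi]

end IsPalindromic

open Polynomial Complex in
/-- The functions of `k` of the form `P(z) / z ^ α`, with `z = e ^ {ik}` and `P` palindromic
relative to the degree `2 * α`. -/
def palindromicQuotients : Subalgebra ℂ (ℝ → ℂ) where
  carrier := {f | ∃ (α : ℕ) (P : ℂ[X]), IsPalindromic (2 * α) P ∧
    ∀ k : ℝ, f k * exp (I * k) ^ α = P.eval (exp (I * k))}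
  mul_mem' := by
    rintro f g ⟨α, P, hP, hf⟩ ⟨β, Q, hQ, hg⟩
    refine ⟨α + β, P * Q, mul_add 2 α β ▸ hP.mul hQ, fun k => ?_⟩
    rw [eval_mul, ← hf, ← hg, Pi.mul_apply]
    ring
  add_mem' := by
    rintro f g ⟨α, P, hP, hf⟩ ⟨β, Q, hQ, hg⟩
    refine ⟨α + β, P * X ^ β + X ^ α * Q, mul_add 2 α β ▸
      (hP.mul (.X_pow β)).add ((IsPalindromic.X_pow α).mul hQ), fun k => ?_⟩
    simp only [eval_add, eval_mul, eval_pow, eval_X, ← hf, ← hg, Pi.add_apply]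
    ring
  algebraMap_mem' r := ⟨0, C r, .const r, fun k => by simp⟩

open Polynomial Complex in
theorem cos_mem_palindromicQuotients (n : ℕ) :
    (fun k : ℝ => (Real.cos (n * k) : ℂ)) ∈ palindromicQuotients := by
  refine ⟨n, C (1 / 2) * (1 + X ^ (2 * n)),
    zero_add (2 * n) ▸ (IsPalindromic.const _).mul (.one_add_X_pow _), fun k => ?_⟩
  have hpos : exp (n * k * I) = exp (I * k) ^ n := by
    rw [← exp_nat_mul]; ring_nf
  have hneg : exp (-(n * k) * I) = (exp (I * k) ^ n)⁻¹ := by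
    rw [neg_mul, exp_neg, hpos]
  have hne : exp (I * k) ≠ 0 := exp_ne_zero _
  push_cast
  rw [Complex.cos, hpos, hneg]
  simp only [eval_mul, eval_C, eval_add, eval_one, eval_pow, eval_X]
  field_simp
  ring

theorem sin_sq_mem_palindromicQuotients (n : ℕ) :
    (fun k : ℝ => (Real.sin (n * k) : ℂ) ^ 2) ∈ palindromicQuotients := by
  have h := sub_mem (algebraMap_mem palindromicQuotients (1 / 2 : ℂ))
    (Subalgebra.smul_mem _ (cos_mem_palindromicQuotients (2 * n)) (1 / 2 : ℂ))
  convert h using 1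
  funext k
  have hk : Real.sin (n * k) ^ 2 = 1 / 2 - 1 / 2 * Real.cos ((2 * n : ℕ) * k) := by
    rw [Real.sin_sq_eq_half_sub]
    push_cast
    ring_nf
  simpa using congrArg (fun x : ℝ => (x : ℂ)) hk

/-- Lemma 1 of the paper: an even trigonometric polynomial
`F(k) = Σ_l c_l cos^{m_l}(a_l k) sin^{2 p_l}(b_l k)` transforms, under `z = e^{ik}`,
into `P(z)/z^α` with `P` palindromic of degree (at most) `2α`. -/
theorem even_trig_poly_eq_palindromic_div
    {ι : Type*} [Fintype ι] (c : ι → ℂ) (a b m p : ι → ℕ)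
    (F : ℝ → ℂ)
    (hF : ∀ k : ℝ, F k =
      ∑ l : ι, c l * ((Real.cos ((a l : ℝ) * k) : ℂ)) ^ (m l)
        * ((Real.sin ((b l : ℝ) * k) : ℂ)) ^ (2 * p l)) :
    ∃ (α : ℕ) (P : Polynomial ℂ),
      P.natDegree ≤ 2 * α ∧
      (∀ i ≤ 2 * α, P.coeff i = P.coeff (2 * α - i)) ∧
      ∀ k : ℝ, F k = P.eval (Complex.exp (Complex.I * k))
        / Complex.exp (Complex.I * (α : ℂ) * k) := by
  have hmem : F ∈ palindromicQuotients := by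
    have h : ∑ l, c l • ((fun k : ℝ => (Real.cos (a l * k) : ℂ)) ^ m l *
        (fun k : ℝ => (Real.sin (b l * k) : ℂ) ^ 2) ^ p l) ∈ palindromicQuotients :=
      sum_mem fun l _ => Subalgebra.smul_mem _
        (mul_mem (pow_mem (cos_mem_palindromicQuotients (a l)) _)
          (pow_mem (sin_sq_mem_palindromicQuotients (b l)) _)) _
    convert h using 1
    funext k
    simp [hF, pow_mul, mul_assoc]
  obtain ⟨α, P, hP, h⟩ := hmem
  refine ⟨α, P, hP.1, fun i hi => hP.coeff_eq hi, fun k => ?_⟩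
  rw [eq_div_iff (Complex.exp_ne_zero _), ← h, ← Complex.exp_nat_mul]
  ring_nf
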